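/- arXiv:1005.0438 — 2 statements merged into one kernel-verified Lean document; each statement's English description precedes it below -/
import Mathlib

section
/- With notation as in the refined Pan–Yang inequality, equality ∫₀^{2π} (u''+u)² dθ = (2/π)(L² − 4πA) + 2A holds if and only if the Fourier coefficients aₙ, bₙ of u vanish for all n ≥ 3, i.e. u(θ) = a₀ + a₁cos θ + b₁sin θ + a₂cos 2θ + b₂sin 2θ. -/
open Real intervalIntegral

lemma py_congr {f g : ℤ → ℝ} {x y : ℝ} (h : HasSum f x) (hfg : ∀ n, g n = f n) (hxy : y = x) :
    HasSum g y := by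
  rw [hxy, funext hfg]
  exact h

lemma py_parseval (f : ℝ → ℝ) (hf : Continuous f) :
    HasSum (fun n : ℤ => (∫ θ in (0:ℝ)..(2 * Real.pi), f θ * Real.cos (n * θ)) ^ 2
      + (∫ θ in (0:ℝ)..(2 * Real.pi), f θ * Real.sin (n * θ)) ^ 2)
      (2 * Real.pi * ∫ θ in (0:ℝ)..(2 * Real.pi), f θ ^ 2) := by
  have hab : (0:ℝ) < 2 * Real.pi := Real.two_pi_pos
  have hc : Continuous (fun x => (f x : ℂ)) := Complex.continuous_ofReal.comp hf
  have hL2 : MeasureTheory.MemLp (fun x => (f x : ℂ)) 2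
      (MeasureTheory.volume.restrict (Set.Ioc 0 (2 * Real.pi))) := by
    obtain ⟨C, hC⟩ := (isCompact_Icc (a := (0:ℝ)) (b := 2 * Real.pi)).exists_bound_of_continuousOn
      hc.continuousOn
    refine MeasureTheory.MemLp.of_bound hc.aestronglyMeasurable C ?_
    filter_upwards [MeasureTheory.ae_restrict_mem measurableSet_Ioc] with x hx
    exact hC x (Set.Ioc_subset_Icc_self hx)
  have h := (hasSum_sq_fourierCoeffOn hab hL2).mul_left ((2 * Real.pi) ^ 2)
  have key : ∀ n : ℤ, fourierCoeffOn hab (fun x => (f x : ℂ)) n =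
      ((1 / (2 * Real.pi) * ∫ θ in (0:ℝ)..(2 * Real.pi), f θ * Real.cos (n * θ) : ℝ) : ℂ)
      + ((-(1 / (2 * Real.pi)) * ∫ θ in (0:ℝ)..(2 * Real.pi), f θ * Real.sin (n * θ) : ℝ) : ℂ)
        * Complex.I := by
    intro n
    rw [fourierCoeffOn_eq_integral]
    have e : ∀ x : ℝ, fourier (-n) (x : AddCircle (2 * Real.pi - 0)) • (f x : ℂ) =
        ((f x * Real.cos (n * x) : ℝ) : ℂ) - ((f x * Real.sin (n * x) : ℝ) : ℂ) * Complex.I := by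
      intro x
      rw [fourier_coe_apply]
      have : (2 * Real.pi * Complex.I * ((-n : ℤ) : ℂ) * x / ((2 * Real.pi - 0 : ℝ) : ℂ))
          = ((-(n * x) : ℝ) : ℂ) * Complex.I := by
        have : (Real.pi : ℂ) ≠ 0 := by exact_mod_cast Real.pi_ne_zero
        push_cast
        field_simp
        ring
      rw [this, Complex.exp_mul_I, ← Complex.ofReal_cos, ← Complex.ofReal_sin, Real.cos_neg,
        Real.sin_neg, smul_eq_mul]
      push_cast
      ring
    simp_rw [e]
    rw [intervalIntegral.integral_sub, intervalIntegral.integral_mul_const,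
      intervalIntegral.integral_ofReal, intervalIntegral.integral_ofReal, Complex.real_smul]
    · push_cast
      simp only [sub_zero]
      ring
    · exact Continuous.intervalIntegrable (by fun_prop) _ _
    · exact Continuous.intervalIntegrable (by fun_prop) _ _
  have hpi := Real.pi_ne_zero
  refine py_congr h ?_ ?_
  · intro n
    rw [key, ← Complex.normSq_eq_norm_sq, Complex.normSq_add_mul_I]
    field_simp
  · simp only [Complex.norm_real, sub_zero, smul_eq_mul, Real.norm_eq_abs, sq_abs]
    field_simp

lemma py_cos (f f' : ℝ → ℝ) (hf : ∀ x, HasDerivAt f (f' x) x) (hf' : Continuous f')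
    (hp : f (2 * Real.pi) = f 0) (n : ℤ) :
    ∫ θ in (0:ℝ)..(2 * Real.pi), f' θ * Real.cos (n * θ) =
      n * ∫ θ in (0:ℝ)..(2 * Real.pi), f θ * Real.sin (n * θ) := by
  have hd : ∀ x : ℝ, HasDerivAt (fun x : ℝ => Real.cos (n * x)) (-Real.sin (n * x) * n) x := by
    intro x
    simpa using ((hasDerivAt_id x).const_mul (n : ℝ)).cos
  have h := intervalIntegral.integral_deriv_mul_eq_sub (a := 0) (b := 2 * Real.pi)
    (u := f) (u' := f') (fun x _ => hf x) (fun x _ => hd x) (hf'.intervalIntegrable _ _)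
    (Continuous.intervalIntegrable (by fun_prop) _ _)
  have hfc : Continuous f := continuous_iff_continuousAt.2 fun x => (hf x).continuousAt
  rw [intervalIntegral.integral_add (Continuous.intervalIntegrable (by fun_prop) _ _)
    (Continuous.intervalIntegrable (by fun_prop) _ _), hp, Real.cos_int_mul_two_pi] at h
  have e : ∫ x in (0:ℝ)..(2 * Real.pi), f x * (-Real.sin (n * x) * n) =
      (-n : ℝ) * ∫ x in (0:ℝ)..(2 * Real.pi), f x * Real.sin (n * x) := by
    rw [← intervalIntegral.integral_const_mul]
    congr 1; funext x; ring
  rw [e] at h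
  simp at h
  linarith

lemma py_sin (f f' : ℝ → ℝ) (hf : ∀ x, HasDerivAt f (f' x) x) (hf' : Continuous f')
    (n : ℤ) :
    ∫ θ in (0:ℝ)..(2 * Real.pi), f' θ * Real.sin (n * θ) =
      -(n * ∫ θ in (0:ℝ)..(2 * Real.pi), f θ * Real.cos (n * θ)) := by
  have hd : ∀ x : ℝ, HasDerivAt (fun x : ℝ => Real.sin (n * x)) (Real.cos (n * x) * n) x := by
    intro x
    simpa using ((hasDerivAt_id x).const_mul (n : ℝ)).sin
  have h := intervalIntegral.integral_deriv_mul_eq_sub (a := 0) (b := 2 * Real.pi)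
    (u := f) (u' := f') (fun x _ => hf x) (fun x _ => hd x) (hf'.intervalIntegrable _ _)
    (Continuous.intervalIntegrable (by fun_prop) _ _)
  have hfc : Continuous f := continuous_iff_continuousAt.2 fun x => (hf x).continuousAt
  have hs : Real.sin (n * (2 * Real.pi)) = 0 := by
    have := Real.sin_int_mul_pi (2 * n)
    push_cast at this
    rw [← this]; congr 1; ring
  rw [intervalIntegral.integral_add (Continuous.intervalIntegrable (by fun_prop) _ _)
    (Continuous.intervalIntegrable (by fun_prop) _ _), hs] at h
  have e : ∫ x in (0:ℝ)..(2 * Real.pi), f x * (Real.cos (n * x) * n) =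
      (n : ℝ) * ∫ x in (0:ℝ)..(2 * Real.pi), f x * Real.cos (n * x) := by
    rw [← intervalIntegral.integral_const_mul]
    congr 1; funext x; ring
  rw [e] at h
  simp at h
  linarith

/-- Equality case of the refined Pan–Yang inequality: equality holds iff all Fourier
coefficients of the support function `u` of order `n ≥ 3` vanish. -/
theorem refined_pan_yang_equality_iff
    (u : ℝ → ℝ) (hu : ContDiff ℝ (⊤ : ℕ∞) u)
    (hper : Function.Periodic u (2 * Real.pi))
    (hconv : ∀ θ : ℝ, 0 < deriv (deriv u) θ + u θ)
    (a b : ℕ → ℝ)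
    (ha : ∀ n : ℕ, a n = (1 / Real.pi) * ∫ θ in (0:ℝ)..(2 * Real.pi), u θ * Real.cos (n * θ))
    (hb : ∀ n : ℕ, b n = (1 / Real.pi) * ∫ θ in (0:ℝ)..(2 * Real.pi), u θ * Real.sin (n * θ))
    (L A : ℝ)
    (hL : L = ∫ θ in (0:ℝ)..(2 * Real.pi), u θ)
    (hA : A = (1/2) * ∫ θ in (0:ℝ)..(2 * Real.pi), u θ * (deriv (deriv u) θ + u θ)) :
    (∫ θ in (0:ℝ)..(2 * Real.pi), (deriv (deriv u) θ + u θ) ^ 2) =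
      (2 / Real.pi) * (L ^ 2 - 4 * Real.pi * A) + 2 * A ↔
      ∀ n : ℕ, 3 ≤ n → a n = 0 ∧ b n = 0 := by
  have hpi := Real.pi_pos
  have hu0 : Continuous u := hu.continuous
  have hu1 : ContDiff ℝ (⊤ : ℕ∞) (deriv u) := (contDiff_infty_iff_deriv.1 hu).2
  have hu2 : ContDiff ℝ (⊤ : ℕ∞) (deriv (deriv u)) := (contDiff_infty_iff_deriv.1 hu1).2
  have hc1 : Continuous (deriv u) := hu1.continuous
  have hc2 : Continuous (deriv (deriv u)) := hu2.continuous
  have hd1 : ∀ x, HasDerivAt u (deriv u x) x := fun x =>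
    ((contDiff_infty_iff_deriv.1 hu).1 x).hasDerivAt
  have hd2 : ∀ x, HasDerivAt (deriv u) (deriv (deriv u) x) x := fun x =>
    ((contDiff_infty_iff_deriv.1 hu1).1 x).hasDerivAt
  have hp0 : u (2 * Real.pi) = u 0 := by simpa using hper 0
  have hp1 : deriv u (2 * Real.pi) = deriv u 0 := by
    have h1 : (fun x => u (x + 2 * Real.pi)) = u := funext hper
    have h2 := deriv_comp_add_const u (2 * Real.pi) 0
    rw [h1, zero_add] at h2
    exact h2.symm
  set P : ℤ → ℝ := fun n => ∫ θ in (0:ℝ)..(2 * Real.pi), u θ * Real.cos (n * θ) with hP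
  set Q : ℤ → ℝ := fun n => ∫ θ in (0:ℝ)..(2 * Real.pi), u θ * Real.sin (n * θ) with hQ
  have hP2 : ∀ n : ℤ, ∫ θ in (0:ℝ)..(2 * Real.pi),
      (deriv (deriv u) θ + 5 / 2 * u θ) * Real.cos (n * θ) = (5 / 2 - (n:ℝ) ^ 2) * P n := by
    intro n
    simp_rw [add_mul, mul_assoc]
    rw [intervalIntegral.integral_add (Continuous.intervalIntegrable (by fun_prop) _ _)
      (Continuous.intervalIntegrable (by fun_prop) _ _), intervalIntegral.integral_const_mul,
      py_cos _ _ hd2 hc2 hp1 n, py_sin _ _ hd1 hc1 n]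
    simp only [hP]
    ring
  have hQ2 : ∀ n : ℤ, ∫ θ in (0:ℝ)..(2 * Real.pi),
      (deriv (deriv u) θ + 5 / 2 * u θ) * Real.sin (n * θ) = (5 / 2 - (n:ℝ) ^ 2) * Q n := by
    intro n
    simp_rw [add_mul, mul_assoc]
    rw [intervalIntegral.integral_add (Continuous.intervalIntegrable (by fun_prop) _ _)
      (Continuous.intervalIntegrable (by fun_prop) _ _), intervalIntegral.integral_const_mul,
      py_sin _ _ hd2 hc2 n, py_cos _ _ hd1 hc1 hp0 n]
    simp only [hQ]
    ring
  have S1 := py_parseval (fun θ => deriv (deriv u) θ + 5 / 2 * u θ) (by fun_prop)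
  simp only [hP2, hQ2] at S1
  have S2 := (py_parseval u hu0).mul_left (9 / 4)
  have S3 := S1.sub S2
  set F : ℤ → ℝ := fun n => if n = 0 then 0 else
    ((n:ℝ) ^ 2 - 1) * ((n:ℝ) ^ 2 - 4) * (P n ^ 2 + Q n ^ 2) with hF
  have hP0 : P 0 = L := by simp [hP, hL]
  have hQ0 : Q 0 = 0 := by simp [hQ]
  have S0 : HasSum (fun n : ℤ => if n = 0 then 4 * L ^ 2 else 0) (4 * L ^ 2) :=
    hasSum_ite_eq 0 (4 * L ^ 2)
  have S4 := S3.sub S0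
  have hIw : IntervalIntegrable (fun θ => (deriv (deriv u) θ + u θ) ^ 2) MeasureTheory.volume
      0 (2 * Real.pi) := Continuous.intervalIntegrable (by fun_prop) _ _
  have hIu : IntervalIntegrable (fun θ => u θ * (deriv (deriv u) θ + u θ)) MeasureTheory.volume
      0 (2 * Real.pi) := Continuous.intervalIntegrable (by fun_prop) _ _
  have hI2 : IntervalIntegrable (fun θ => u θ ^ 2) MeasureTheory.volume
      0 (2 * Real.pi) := Continuous.intervalIntegrable (by fun_prop) _ _
  have hint : ∫ θ in (0:ℝ)..(2 * Real.pi), (deriv (deriv u) θ + 5 / 2 * u θ) ^ 2 =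
      (∫ θ in (0:ℝ)..(2 * Real.pi), (deriv (deriv u) θ + u θ) ^ 2)
      + 3 * (∫ θ in (0:ℝ)..(2 * Real.pi), u θ * (deriv (deriv u) θ + u θ))
      + 9 / 4 * ∫ θ in (0:ℝ)..(2 * Real.pi), u θ ^ 2 := by
    rw [← intervalIntegral.integral_const_mul, ← intervalIntegral.integral_const_mul,
      ← intervalIntegral.integral_add hIw (hIu.const_mul 3),
      ← intervalIntegral.integral_add (hIw.add (hIu.const_mul 3)) (hI2.const_mul (9 / 4))]
    congr 1; funext θ; ring
  set W := ∫ θ in (0:ℝ)..(2 * Real.pi), (deriv (deriv u) θ + u θ) ^ 2 with hW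
  have S5 : HasSum F (2 * Real.pi * (W - ((2 / Real.pi) * (L ^ 2 - 4 * Real.pi * A) + 2 * A))) := by
    refine py_congr S4 ?_ ?_
    · intro n
      by_cases hn : n = 0
      · subst hn
        simp only [hF, if_true, hP0, hQ0]
        have h1 : (∫ θ in (0:ℝ)..(2 * Real.pi), u θ * Real.cos ((0:ℤ) * θ)) = L := hP0
        have h2 : (∫ θ in (0:ℝ)..(2 * Real.pi), u θ * Real.sin ((0:ℤ) * θ)) = 0 := hQ0
        rw [h1, h2]
        push_cast
        ring
      · simp only [hF, if_neg hn, hP, hQ]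
        ring
    · rw [hint, hA]
      field_simp
      ring
  have hFnn : ∀ n, 0 ≤ F n := by
    intro n
    simp only [hF]
    split_ifs with hn
    · exact le_rfl
    · have h1 : (1:ℝ) ≤ (n:ℝ) ^ 2 := by
        have : (1:ℤ) ≤ n ^ 2 := by have := sq_pos_of_ne_zero hn; omega
        exact_mod_cast this
      have h2 : (n:ℝ) ^ 2 = 1 ∨ (4:ℝ) ≤ (n:ℝ) ^ 2 := by
        have : n ^ 2 = 1 ∨ (4:ℤ) ≤ n ^ 2 := by
          by_cases h : n = 1 ∨ n = -1
          · left; rcases h with h | h <;> simp [h]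
          · right
            have : 2 ≤ n ∨ n ≤ -2 := by omega
            rcases this with h | h <;> nlinarith
        exact_mod_cast this
      rcases h2 with h2 | h2
      · simp [h2]
      · have := mul_nonneg (mul_nonneg (sub_nonneg.2 h1) (sub_nonneg.2 h2))
          (add_nonneg (sq_nonneg (P n)) (sq_nonneg (Q n)))
        exact this
  have hab : ∀ n : ℕ, (a n = 0 ∧ b n = 0) ↔ P n ^ 2 + Q n ^ 2 = 0 := by
    intro n
    have h1 : a n = 1 / Real.pi * P n := by rw [ha]; simp [hP]
    have h2 : b n = 1 / Real.pi * Q n := by rw [hb]; simp [hQ]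
    have hi : 1 / Real.pi ≠ 0 := by positivity
    rw [h1, h2, mul_eq_zero_iff_left hi, mul_eq_zero_iff_left hi]
    constructor
    · rintro ⟨h, h'⟩; simp [h, h']
    · intro h
      constructor <;> nlinarith [sq_nonneg (P n), sq_nonneg (Q n)]
  have hPn : ∀ n, P (-n) = P n := by intro n; simp [hP]
  have hQn : ∀ n, Q (-n) = - Q n := by intro n; simp [hQ]
  have hFz : F = 0 ↔ ∀ n : ℕ, 3 ≤ n → P n ^ 2 + Q n ^ 2 = 0 := by
    constructor
    · intro h n hn
      have h1 := congrFun h (n : ℤ)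
      have hn0 : (n : ℤ) ≠ 0 := by omega
      simp only [hF, if_neg hn0, Pi.zero_apply, Int.cast_natCast] at h1
      have h3 : (3:ℝ) ≤ n := by exact_mod_cast hn
      rcases mul_eq_zero.1 h1 with h2 | h2
      · exfalso
        have : 0 < ((n:ℝ) ^ 2 - 1) * ((n:ℝ) ^ 2 - 4) := mul_pos (by nlinarith) (by nlinarith)
        linarith
      · exact h2
    · intro h
      funext n
      simp only [hF, Pi.zero_apply]
      split_ifs with hn
      · rfl
      · by_cases h3 : 3 ≤ n.natAbs
        · have h4 := h _ h3
          have h5 : P n ^ 2 + Q n ^ 2 = 0 := by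
            rcases Int.natAbs_eq n with h6 | h6
            · rw [h6]; exact h4
            · rw [h6, hPn, hQn, neg_sq]; exact h4
          rw [h5, mul_zero]
        · have : n = 1 ∨ n = -1 ∨ n = 2 ∨ n = -2 := by omega
          rcases this with h | h | h | h <;> subst h <;> norm_num
  have hmain : W = (2 / Real.pi) * (L ^ 2 - 4 * Real.pi * A) + 2 * A ↔ F = 0 := by
    constructor
    · intro h
      rw [h, sub_self, mul_zero] at S5
      exact (hasSum_zero_iff_of_nonneg hFnn).1 S5
    · intro h
      rw [h] at S5
      have h1 := S5.unique hasSum_zero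
      rcases mul_eq_zero.1 h1 with h2 | h2
      · linarith
      · linarith
  rw [hmain, hFz]
  exact forall_congr' fun n => imp_congr_right fun _ => (hab n).symm
end

section
/- Let α be a smooth convex closed plane curve with curvature k(θ) > 0 as a function of outward normal angle, length L, and area A, and for r ≥ 0 let the outer parallel curve at distance r have curvature k_r(θ) = k(θ)/(1 + r k(θ)), length L_r = L + 2πr, and area A_r = A + rL + πr². Then d/dr ∫₀^{2π} log(k_r(θ)√(A_r/π)) dθ = −∫₀^{2π} k_r(θ) dθ + πL_r/A_r ≤ 0. -/
open Real intervalIntegral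

lemma aux_cot_cont (g g' : ℝ → ℝ) (hg : ∀ t, HasDerivAt g (g' t) t) (φ : ℝ) (h0 : g φ = 0) :
    ContinuousAt (fun t => g t ^ 2 * (cos (t - φ) / sin (t - φ))) φ := by
  have h1 : Filter.Tendsto (fun t => slope (fun s => g s ^ 2) φ t) (nhdsWithin φ {φ}ᶜ) (nhds 0) := by
    have := ((hg φ).pow 2)
    rw [h0] at this
    simp at this
    exact hasDerivAt_iff_tendsto_slope.1 this
  have h2 : Filter.Tendsto (fun t => slope (fun s => sin (s - φ)) φ t)
      (nhdsWithin φ {φ}ᶜ) (nhds 1) := by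
    have := ((hasDerivAt_id φ).sub_const φ).sin
    simp at this
    exact hasDerivAt_iff_tendsto_slope.1 this
  have h3 : Filter.Tendsto (fun t => cos (t - φ)) (nhdsWithin φ {φ}ᶜ) (nhds 1) := by
    have : ContinuousAt (fun t => cos (t - φ)) φ := by fun_prop
    have h := this.tendsto
    simp only [sub_self, cos_zero] at h
    exact h.mono_left nhdsWithin_le_nhds
  have h4 := (h1.div h2 one_ne_zero).mul h3
  rw [continuousAt_iff_punctured_nhds]
  simp only [h0]
  have e : (0:ℝ)^2 * (cos (φ - φ) / sin (φ - φ)) = 0 / 1 * 1 := by simp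
  rw [e]
  refine h4.congr' ?_
  filter_upwards [self_mem_nhdsWithin] with t ht
  have : t - φ ≠ 0 := sub_ne_zero.2 ht
  simp only [slope_def_field, h0, Pi.div_apply, sub_self, sin_zero]
  by_cases hs : sin (t - φ) = 0
  · simp [hs]
  · field_simp
    ring

lemma aux_cot_deriv (g g' : ℝ → ℝ) (hg : ∀ t, HasDerivAt g (g' t) t) (φ t : ℝ)
    (hs : sin (t - φ) ≠ 0) :
    HasDerivAt (fun t => g t ^ 2 * (cos (t - φ) / sin (t - φ)))
      (g' t ^ 2 - g t ^ 2 - (g' t - g t * (cos (t - φ) / sin (t - φ))) ^ 2) t := by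
  have hc : HasDerivAt (fun t => cos (t - φ)) (-sin (t - φ)) t := by
    simpa using ((hasDerivAt_id t).sub_const φ).cos
  have hsn : HasDerivAt (fun t => sin (t - φ)) (cos (t - φ)) t := by
    simpa using ((hasDerivAt_id t).sub_const φ).sin
  have := ((hg t).pow 2).mul (hc.div hsn hs)
  refine this.congr_deriv ?_
  simp only [Pi.pow_apply, Pi.div_apply]
  field_simp
  ring

lemma aux_wirtinger (g g' : ℝ → ℝ) (hg : ∀ t, HasDerivAt g (g' t) t) (hg' : Continuous g')
    (a φ : ℝ) (hφ : φ ∈ Set.Ioo a (a + π)) (hp : g a = g (a + π)) (h0 : g φ = 0) :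
    0 ≤ ∫ t in a..(a + π), (g' t ^ 2 - g t ^ 2) := by
  obtain ⟨h1, h2⟩ := hφ
  have gc : Continuous g := continuous_iff_continuousAt.2 fun t => (hg t).continuousAt
  have hsin : ∀ t ∈ Set.Icc a (a + π), t ≠ φ → sin (t - φ) ≠ 0 := by
    intro t ht hne
    rcases lt_or_gt_of_ne hne with h | h
    · exact (sin_neg_of_neg_of_neg_pi_lt (by linarith) (by linarith [ht.1])).ne
    · exact (sin_pos_of_pos_of_lt_pi (by linarith) (by linarith [ht.2])).ne'
  have hcont : ContinuousOn (fun t => g t ^ 2 * (cos (t - φ) / sin (t - φ)))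
      (Set.Icc a (a + π)) := by
    intro t ht
    by_cases e : t = φ
    · rw [e]; exact (aux_cot_cont g g' hg φ h0).continuousWithinAt
    · exact (aux_cot_deriv g g' hg φ t (hsin t ht e)).continuousAt.continuousWithinAt
  have fc : Continuous (fun t => g' t ^ 2 - g t ^ 2) := by fun_prop
  have A := sub_le_integral_of_hasDeriv_right_of_le h1.le
    (hcont.mono (Set.Icc_subset_Icc_right h2.le))
    (fun t ht => (aux_cot_deriv g g' hg φ t
      (hsin t ⟨ht.1.le, ht.2.le.trans h2.le⟩ ht.2.ne)).hasDerivWithinAt)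
    (fc.integrableOn_Icc (μ := MeasureTheory.volume))
    (fun t _ => by nlinarith [sq_nonneg (g' t - g t * (cos (t - φ) / sin (t - φ)))])
  have B := sub_le_integral_of_hasDeriv_right_of_le h2.le
    (hcont.mono (Set.Icc_subset_Icc_left h1.le))
    (fun t ht => (aux_cot_deriv g g' hg φ t
      (hsin t ⟨h1.le.trans ht.1.le, ht.2.le⟩ ht.1.ne')).hasDerivWithinAt)
    (fc.integrableOn_Icc (μ := MeasureTheory.volume))
    (fun t _ => by nlinarith [sq_nonneg (g' t - g t * (cos (t - φ) / sin (t - φ)))])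
  rw [← integral_add_adjacent_intervals (fc.intervalIntegrable a φ) (fc.intervalIntegrable φ _)]
  have e : a + π - φ = (a - φ) + π := by ring
  rw [e, cos_add_pi, sin_add_pi, ← hp, neg_div_neg_eq] at B
  linarith

lemma aux_half (h h' h'' : ℝ → ℝ) (d1 : ∀ t, HasDerivAt h (h' t) t)
    (d2 : ∀ t, HasDerivAt h' (h'' t) t) (hc : Continuous h'') (a : ℝ)
    (e0 : h a = h (a + π)) (e1 : h' a = h' (a + π)) (pos : ∀ t, 0 < h'' t + h t) :
    π * ∫ t in a..(a + π), h t ^ 2 * (h'' t + h t) ≤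
      (∫ t in a..(a + π), h t * (h'' t + h t)) * ∫ t in a..(a + π), h t := by
  have c0 : Continuous h := continuous_iff_continuousAt.2 fun t => (d1 t).continuousAt
  have c1 : Continuous h' := continuous_iff_continuousAt.2 fun t => (d2 t).continuousAt
  set l := ∫ t in a..(a + π), h t with hl
  set α := ∫ t in a..(a + π), h t * (h'' t + h t) with hα
  have i2 : ∫ t in a..(a + π), h'' t = 0 := by
    rw [integral_eq_sub_of_hasDerivAt (fun t _ => d2 t) (hc.intervalIntegrable _ _), e1]; ring
  have il : ∫ t in a..(a + π), (h'' t + h t) = l := by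
    rw [integral_add (hc.intervalIntegrable _ _) (c0.intervalIntegrable _ _), i2, zero_add]
  have i3 : ∫ t in a..(a + π), (h' t * h' t + h t * h'' t) = 0 := by
    rw [integral_eq_sub_of_hasDerivAt (f := fun t => h t * h' t) (fun t _ => (d1 t).mul (d2 t))
      ((by fun_prop : Continuous fun t => h' t * h' t + h t * h'' t).intervalIntegrable _ _),
      e1, e0]; ring
  have key : ∀ φ ∈ Set.Ioo a (a + π), 0 ≤ 2 * l * h φ - α - π * h φ ^ 2 := by
    intro φ hφ
    have W := aux_wirtinger (fun t => h t - h φ) h' (fun t => (d1 t).sub_const _) c1 a φ hφ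
      (by simp [e0]) (by simp)
    have E : ∫ t in a..(a + π), (h' t ^ 2 - (h t - h φ) ^ 2) =
        ∫ t in a..(a + π), (((h' t * h' t + h t * h'' t) - h t * (h'' t + h t)) +
          (2 * h φ * h t - h φ ^ 2)) := by
      congr 1; ext t; ring
    rw [E, integral_add, integral_sub, integral_sub, i3, integral_const_mul, integral_const] at W
    · simp only [smul_eq_mul, add_sub_cancel_left] at W
      linarith
    all_goals exact Continuous.intervalIntegrable (by fun_prop) _ _
  have N : 0 ≤ ∫ φ in a..(a + π), (2 * l * h φ - α - π * h φ ^ 2) * (h'' φ + h φ) := by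
    rw [integral_of_le (by linarith [pi_pos]), MeasureTheory.integral_Ioc_eq_integral_Ioo]
    exact MeasureTheory.setIntegral_nonneg measurableSet_Ioo
      fun φ hφ => mul_nonneg (key φ hφ) (pos φ).le
  have E : ∫ φ in a..(a + π), (2 * l * h φ - α - π * h φ ^ 2) * (h'' φ + h φ) =
      ∫ φ in a..(a + π), (2 * l * (h φ * (h'' φ + h φ)) - α * (h'' φ + h φ) -
        π * (h φ ^ 2 * (h'' φ + h φ))) := by
    congr 1; ext t; ring
  rw [E, integral_sub, integral_sub, integral_const_mul, integral_const_mul, integral_const_mul,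
    il] at N
  · linarith
  all_goals exact Continuous.intervalIntegrable (by fun_prop) _ _

lemma aux_origin (u u' u'' : ℝ → ℝ) (d1 : ∀ t, HasDerivAt u (u' t) t)
    (d2 : ∀ t, HasDerivAt u' (u'' t) t) (hc : Continuous u'')
    (p0 : Function.Periodic u (2 * π)) (p1 : Function.Periodic u' (2 * π))
    (p2 : Function.Periodic u'' (2 * π)) (pos : ∀ t, 0 < u'' t + u t) :
    ∃ v : ℝ → ℝ, Continuous v ∧ ∫ t in (0:ℝ)..(2 * π), v t = ∫ t in (0:ℝ)..(2 * π), u t ∧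
      π * ∫ t in (0:ℝ)..(2 * π), v t ^ 2 * (u'' t + u t) ≤
      (1 / 2 * ∫ t in (0:ℝ)..(2 * π), u t * (u'' t + u t)) * ∫ t in (0:ℝ)..(2 * π), u t := by
  have c0 : Continuous u := continuous_iff_continuousAt.2 fun t => (d1 t).continuousAt
  have c1 : Continuous u' := continuous_iff_continuousAt.2 fun t => (d2 t).continuousAt
  set A := 1 / 2 * ∫ t in (0:ℝ)..(2 * π), u t * (u'' t + u t) with hA
  -- explicit antiderivatives
  let C : ℝ → ℝ := fun t => u' t * cos t + u t * sin t
  let S : ℝ → ℝ := fun t => u' t * sin t - u t * cos t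
  let U : ℝ → ℝ := fun x => ∫ t in (0:ℝ)..x, u t * (u'' t + u t)
  have iC : ∀ x y, ∫ t in x..y, cos t * (u'' t + u t) = C y - C x := by
    intro x y
    refine integral_eq_sub_of_hasDerivAt (fun t _ => ?_)
      (Continuous.intervalIntegrable (by fun_prop) _ _)
    exact (((d2 t).mul (hasDerivAt_cos t)).add ((d1 t).mul (hasDerivAt_sin t))).congr_deriv
      (by ring)
  have iS : ∀ x y, ∫ t in x..y, sin t * (u'' t + u t) = S y - S x := by
    intro x y
    refine integral_eq_sub_of_hasDerivAt (fun t _ => ?_)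
      (Continuous.intervalIntegrable (by fun_prop) _ _)
    exact (((d2 t).mul (hasDerivAt_sin t)).sub ((d1 t).mul (hasDerivAt_cos t))).congr_deriv
      (by ring)
  have ii : ∀ x y, IntervalIntegrable (fun t => u t * (u'' t + u t)) MeasureTheory.volume x y :=
    fun x y => Continuous.intervalIntegrable (by fun_prop) _ _
  have iU : ∀ x y, ∫ t in x..y, u t * (u'' t + u t) = U y - U x := fun x y =>
    (integral_interval_sub_left (ii _ _) (ii _ _)).symm
  have cC : Continuous C := by fun_prop
  have cS : Continuous S := by fun_prop
  have cU : Continuous U := continuous_primitive ii 0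
  let p : ℝ → ℝ := fun a =>
    ((u a - u (a + π)) * cos a - (u' a - u' (a + π)) * sin a) / 2
  let q : ℝ → ℝ := fun a =>
    ((u a - u (a + π)) * sin a + (u' a - u' (a + π)) * cos a) / 2
  have cp : Continuous p := by fun_prop
  have cq : Continuous q := by fun_prop
  let F : ℝ → ℝ := fun a => U (a + π) - U a - p a * (C (a + π) - C a)
    - q a * (S (a + π) - S a) - A
  have cF : Continuous F := by fun_prop
  have u2 : u (π + π) = u 0 := by rw [← p0 0]; congr 1; ring
  have u3 : u' (π + π) = u' 0 := by rw [← p1 0]; congr 1; ring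
  have C2 : C (π + π) = C 0 := by
    simp only [C, u2, u3, cos_add_pi, sin_add_pi, cos_pi, sin_pi, cos_zero, sin_zero]; norm_num
  have S2 : S (π + π) = S 0 := by
    simp only [S, u2, u3, cos_add_pi, sin_add_pi, cos_pi, sin_pi, cos_zero, sin_zero]; norm_num
  have U0 : U 0 = 0 := by simp [U]
  have U2 : U (π + π) = 2 * A := by simp [U, hA, ← two_mul]
  have pp : p π = p 0 := by simp [p, u2, u3]
  have qq : q π = q 0 := by simp [q, u2, u3]
  have FF : F π = - F 0 := by
    simp only [F, C2, S2, U0, U2, pp, qq, zero_add]; ring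
  obtain ⟨a, ha⟩ : ∃ a, F a = 0 := by
    rcases le_total (F 0) 0 with h | h
    · exact mem_range_of_exists_le_of_exists_ge cF ⟨0, h⟩ ⟨π, by linarith⟩
    · exact mem_range_of_exists_le_of_exists_ge cF ⟨π, by linarith⟩ ⟨0, h⟩
  let v : ℝ → ℝ := fun t => u t - p a * cos t - q a * sin t
  let v' : ℝ → ℝ := fun t => u' t + p a * sin t - q a * cos t
  let v'' : ℝ → ℝ := fun t => u'' t + p a * cos t + q a * sin t
  have dv : ∀ t, HasDerivAt v (v' t) t := fun t =>
    (((d1 t).sub ((hasDerivAt_cos t).const_mul (p a))).sub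
      ((hasDerivAt_sin t).const_mul (q a))).congr_deriv (by simp only [v']; ring)
  have dv' : ∀ t, HasDerivAt v' (v'' t) t := fun t =>
    (((d2 t).add ((hasDerivAt_sin t).const_mul (p a))).sub
      ((hasDerivAt_cos t).const_mul (q a))).congr_deriv (by simp only [v'']; ring)
  have cv : Continuous v := by fun_prop
  have cv'' : Continuous v'' := by fun_prop
  have ρv : ∀ t, v'' t + v t = u'' t + u t := fun t => by simp only [v, v'']; ring
  have e0 : v a = v (a + π) := by
    simp only [v, p, q, cos_add_pi, sin_add_pi]
    linear_combination (-(u a - u (a + π))) * (sin_sq_add_cos_sq a)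
  have e1 : v' a = v' (a + π) := by
    simp only [v', p, q, cos_add_pi, sin_add_pi]
    linear_combination (-(u' a - u' (a + π))) * (sin_sq_add_cos_sq a)
  have pv : Function.Periodic v (2 * π) := fun t => by simp [v, p0 t]
  have pv' : Function.Periodic v' (2 * π) := fun t => by simp [v', p1 t]
  have a2 : a + π + π = a + 2 * π := by ring
  have iv : ∀ x y, ∫ t in x..y, v t * (u'' t + u t) =
      U y - U x - p a * (C y - C x) - q a * (S y - S x) := by
    intro x y
    have E : ∫ t in x..y, v t * (u'' t + u t) = ∫ t in x..y, (u t * (u'' t + u t) -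
        p a * (cos t * (u'' t + u t)) - q a * (sin t * (u'' t + u t))) := by
      congr 1; ext t; simp only [v]; ring
    rw [E, integral_sub, integral_sub, integral_const_mul, integral_const_mul, iU, iC, iS]
    all_goals exact Continuous.intervalIntegrable (by fun_prop) _ _
  have g1 : ∫ t in a..(a + π), v t * (u'' t + u t) = A := by
    rw [iv]; simp only [F] at ha; linarith
  have g12 : ∫ t in a..(a + 2 * π), v t * (u'' t + u t) = 2 * A := by
    have per : Function.Periodic (fun t => v t * (u'' t + u t)) (2 * π) :=
      fun t => by simp only [pv t, p2 t, p0 t]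
    rw [per.intervalIntegral_add_eq a 0, iv, zero_add, two_mul π, U2, U0, C2, S2]; ring
  have iiv : ∀ x y, IntervalIntegrable (fun t => v t * (u'' t + u t)) MeasureTheory.volume x y :=
    fun x y => Continuous.intervalIntegrable (by fun_prop) _ _
  have g2 : ∫ t in (a + π)..(a + π + π), v t * (u'' t + u t) = A := by
    have := integral_add_adjacent_intervals (iiv a (a + π)) (iiv (a + π) (a + 2 * π))
    rw [a2]; linarith
  have H1 := aux_half v v' v'' dv dv' cv'' a e0 e1 (fun t => by rw [ρv]; exact pos t)
  have H2 := aux_half v v' v'' dv dv' cv'' (a + π) (by rw [a2, pv, e0]) (by rw [a2, pv', e1])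
    (fun t => by rw [ρv]; exact pos t)
  simp only [ρv] at H1 H2
  rw [g1] at H1
  rw [g2] at H2
  have ivu : ∫ t in (0:ℝ)..(2 * π), v t = ∫ t in (0:ℝ)..(2 * π), u t := by
    simp only [v]
    rw [integral_sub, integral_sub, integral_const_mul, integral_const_mul, integral_cos,
      integral_sin]
    · simp
    all_goals exact Continuous.intervalIntegrable (by fun_prop) _ _
  refine ⟨v, cv, ivu, ?_⟩
  have per2 : Function.Periodic (fun t => v t ^ 2 * (u'' t + u t)) (2 * π) :=
    fun t => by simp only [pv t, p2 t, p0 t]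
  have s1 := per2.intervalIntegral_add_eq a 0
  have s2 := pv.intervalIntegral_add_eq a 0
  rw [zero_add] at s1 s2
  rw [← ivu, ← s1, ← s2]
  have ci : Continuous (fun t => v t ^ 2 * (u'' t + u t)) := by fun_prop
  rw [← integral_add_adjacent_intervals (ci.intervalIntegrable a (a + π))
      (ci.intervalIntegrable (a + π) (a + 2 * π)),
    ← integral_add_adjacent_intervals (cv.intervalIntegrable a (a + π))
      (cv.intervalIntegrable (a + π) (a + 2 * π)), ← a2]
  linarith

/-- Gage's inequality, with positivity of the area. -/
lemma aux_gage (u u' u'' : ℝ → ℝ) (d1 : ∀ t, HasDerivAt u (u' t) t)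
    (d2 : ∀ t, HasDerivAt u' (u'' t) t) (hc : Continuous u'')
    (p0 : Function.Periodic u (2 * π)) (p1 : Function.Periodic u' (2 * π))
    (p2 : Function.Periodic u'' (2 * π)) (pos : ∀ t, 0 < u'' t + u t) (L A : ℝ)
    (hL : L = ∫ t in (0:ℝ)..(2 * π), u t)
    (hA : A = 1 / 2 * ∫ t in (0:ℝ)..(2 * π), u t * (u'' t + u t)) :
    0 < A ∧ π * L / A ≤ ∫ t in (0:ℝ)..(2 * π), (u'' t + u t)⁻¹ := by
  have c0 : Continuous u := continuous_iff_continuousAt.2 fun t => (d1 t).continuousAt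
  obtain ⟨v, cv, ev, hv⟩ := aux_origin u u' u'' d1 d2 hc p0 p1 p2 pos
  rw [← hL, ← hA] at hv
  rw [← hL] at ev
  have ne : ∀ t, u'' t + u t ≠ 0 := fun t => (pos t).ne'
  have cinv : Continuous fun t => (u'' t + u t)⁻¹ := (hc.add c0).inv₀ ne
  have Lpos : 0 < L := by
    have i2 : ∫ t in (0:ℝ)..(2 * π), u'' t = 0 := by
      rw [integral_eq_sub_of_hasDerivAt (fun t _ => d2 t) (hc.intervalIntegrable _ _)]
      have := p1 0
      rw [zero_add] at this
      rw [this, sub_self]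
    have il : ∫ t in (0:ℝ)..(2 * π), (u'' t + u t) = L := by
      rw [integral_add (hc.intervalIntegrable _ _) (c0.intervalIntegrable _ _), i2, zero_add, hL]
    rw [← il]
    exact intervalIntegral_pos_of_pos (Continuous.intervalIntegrable (by fun_prop) _ _) pos
      (by positivity)
  set K := ∫ t in (0:ℝ)..(2 * π), (u'' t + u t)⁻¹ with hK
  set M := ∫ t in (0:ℝ)..(2 * π), v t ^ 2 * (u'' t + u t) with hM
  have Kpos : 0 ≤ K := integral_nonneg (by positivity) fun t _ => (inv_pos.2 (pos t)).le
  have Mpos : 0 ≤ M := integral_nonneg (by positivity) fun t _ =>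
    mul_nonneg (sq_nonneg _) (pos t).le
  have quad : ∀ s : ℝ, 0 ≤ s ^ 2 * M - 2 * s * L + K := by
    intro s
    have N : 0 ≤ ∫ t in (0:ℝ)..(2 * π),
        (s * v t * (u'' t + u t) - 1) ^ 2 * (u'' t + u t)⁻¹ :=
      integral_nonneg (by positivity) fun t _ =>
        mul_nonneg (sq_nonneg _) (inv_pos.2 (pos t)).le
    have E : ∫ t in (0:ℝ)..(2 * π), (s * v t * (u'' t + u t) - 1) ^ 2 * (u'' t + u t)⁻¹ =
        ∫ t in (0:ℝ)..(2 * π), (s ^ 2 * (v t ^ 2 * (u'' t + u t)) - 2 * s * v t +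
          (u'' t + u t)⁻¹) := by
      congr 1; ext t
      have := ne t
      field_simp
      ring
    rw [E, integral_add, integral_sub, integral_const_mul, integral_const_mul, ev] at N
    · exact N
    all_goals exact Continuous.intervalIntegrable (by fun_prop) _ _
  have Apos : 0 < A := by
    by_contra hn
    push Not at hn
    have M0 : M ≤ 0 := by
      by_contra hm
      push Not at hm
      nlinarith [mul_pos pi_pos hm, mul_nonneg (neg_nonneg.2 hn) Lpos.le]
    have M0' : M = 0 := le_antisymm M0 Mpos
    have := quad ((K + 1) / (2 * L))
    have e : 2 * ((K + 1) / (2 * L)) * L = K + 1 := by field_simp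
    rw [M0', e] at this
    linarith
  refine ⟨Apos, ?_⟩
  have h := quad (π / A)
  have h2 : (π / A) ^ 2 * M ≤ π * L / A := by
    have : (π / A) ^ 2 * M = (π / A ^ 2) * (π * M) := by ring
    rw [this]
    calc (π / A ^ 2) * (π * M) ≤ (π / A ^ 2) * (A * L) := by gcongr
      _ = π * L / A := by field_simp
  have h3 : 2 * (π / A) * L = 2 * (π * L / A) := by ring
  linarith

lemma aux_deriv (R : ℝ → ℝ) (hR : Continuous R) (pos : ∀ t, 0 < R t) (r : ℝ) (hr : 0 ≤ r) :
    HasDerivAt (fun x => ∫ t in (0:ℝ)..(2 * π), log (R t + x))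
      (∫ t in (0:ℝ)..(2 * π), (R t + r)⁻¹) r ∧
    ∃ m > 0, ∀ t ∈ Set.Icc 0 (2 * π), m ≤ R t := by
  obtain ⟨t0, -, h0⟩ := (isCompact_Icc (a := (0:ℝ)) (b := 2 * π)).exists_isMinOn
    ⟨0, by constructor <;> positivity⟩ hR.continuousOn
  have hm : ∀ t ∈ Set.Icc 0 (2 * π), R t0 ≤ R t := fun t ht => h0 ht
  refine ⟨?_, R t0, pos t0, hm⟩
  have mp := pos t0
  have hmem : ∀ t, t ∈ Set.uIoc 0 (2 * π) → R t0 ≤ R t := fun t ht => by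
    rw [Set.uIoc_of_le (by positivity)] at ht
    exact hm t ⟨ht.1.le, ht.2⟩
  have hb : ∀ t, t ∈ Set.uIoc 0 (2 * π) → ∀ x ∈ Metric.ball r (R t0 / 2), R t0 / 2 ≤ R t + x := by
    intro t ht x hx
    rw [Metric.mem_ball, Real.dist_eq, abs_lt] at hx
    linarith [hmem t ht]
  refine (intervalIntegral.hasDerivAt_integral_of_dominated_loc_of_deriv_le (bound := fun _ => (R t0 / 2)⁻¹)
    (F' := fun x t => (R t + x)⁻¹)
    (Metric.ball_mem_nhds r (half_pos mp)) ?_ ?_ ?_ ?_ ?_ ?_).2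
  · refine Filter.Eventually.of_forall fun x => ?_
    exact (Real.measurable_log.comp (hR.measurable.add_const x)).aestronglyMeasurable
  · refine Continuous.intervalIntegrable ?_ _ _
    exact (hR.add continuous_const).log fun t => (add_pos_of_pos_of_nonneg (pos t) hr).ne'
  · exact (hR.measurable.add_const r).inv.aestronglyMeasurable
  · refine Filter.Eventually.of_forall fun t ht x hx => ?_
    have := hb t ht x hx
    have p : 0 < R t + x := by linarith
    rw [Real.norm_eq_abs, abs_of_pos (inv_pos.2 p)]
    gcongr
  · simp
  · refine Filter.Eventually.of_forall fun t ht x hx => ?_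
    have := hb t ht x hx
    have p : R t + x ≠ 0 := by linarith
    simpa using ((hasDerivAt_id x).const_add (R t)).log p

/-- Monotonicity formula for convex parallel curves: the entropy of the outer
parallel curve at distance `r` has derivative `−∫ k_r dθ + πL_r/A_r ≤ 0`. -/
theorem parallel_entropy_monotonicity
    (u : ℝ → ℝ) (hu : ContDiff ℝ (⊤ : ℕ∞) u)
    (hper : Function.Periodic u (2 * Real.pi))
    (hconv : ∀ θ : ℝ, 0 < deriv (deriv u) θ + u θ)
    (k : ℝ → ℝ) (hk : ∀ θ : ℝ, k θ = 1 / (deriv (deriv u) θ + u θ))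
    (L A : ℝ)
    (hL : L = ∫ θ in (0:ℝ)..(2 * Real.pi), u θ)
    (hA : A = (1/2) * ∫ θ in (0:ℝ)..(2 * Real.pi), u θ * (deriv (deriv u) θ + u θ)) :
    ∀ r : ℝ, 0 ≤ r →
      HasDerivAt
        (fun ρ => ∫ θ in (0:ℝ)..(2 * Real.pi),
          Real.log ((k θ / (1 + ρ * k θ)) *
            Real.sqrt ((A + ρ * L + Real.pi * ρ ^ 2) / Real.pi)))
        (-(∫ θ in (0:ℝ)..(2 * Real.pi), k θ / (1 + r * k θ)) +
          Real.pi * (L + 2 * Real.pi * r) / (A + r * L + Real.pi * r ^ 2)) r ∧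
      -(∫ θ in (0:ℝ)..(2 * Real.pi), k θ / (1 + r * k θ)) +
          Real.pi * (L + 2 * Real.pi * r) / (A + r * L + Real.pi * r ^ 2) ≤ 0 := by
  intro r hr
  have hu1 : ContDiff ℝ (⊤ : ℕ∞) (deriv u) := (contDiff_infty_iff_deriv.1 hu).2
  have hu2 : ContDiff ℝ (⊤ : ℕ∞) (deriv (deriv u)) := (contDiff_infty_iff_deriv.1 hu1).2
  have c0 := hu.continuous
  have c2 := hu2.continuous
  have d1 : ∀ t, HasDerivAt u (deriv u t) t := fun t =>
    ((contDiff_infty_iff_deriv.1 hu).1 t).hasDerivAt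
  have d2 : ∀ t, HasDerivAt (deriv u) (deriv (deriv u) t) t := fun t =>
    ((contDiff_infty_iff_deriv.1 hu1).1 t).hasDerivAt
  have perd : ∀ f : ℝ → ℝ, Function.Periodic f (2 * π) → Function.Periodic (deriv f) (2 * π) := by
    intro f hf t
    rw [← deriv_comp_add_const]
    congr 1
    ext s
    exact hf s
  have p1 := perd u hper
  have p2 := perd _ p1
  have kk : ∀ x t, k t / (1 + x * k t) = (deriv (deriv u) t + u t + x)⁻¹ := by
    intro x t
    have h := hconv t
    rw [hk]
    by_cases hz : deriv (deriv u) t + u t + x = 0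
    · have hx : x = -(deriv (deriv u) t + u t) := by linarith
      rw [hz, hx]
      have : 1 + -(deriv (deriv u) t + u t) * (1 / (deriv (deriv u) t + u t)) = 0 := by
        field_simp; ring
      rw [this]; simp
    · have h2 : 1 + x * (1 / (deriv (deriv u) t + u t)) ≠ 0 := by
        intro h3
        apply hz
        field_simp at h3
        linarith
      field_simp
  have i2 : ∫ t in (0:ℝ)..(2 * π), deriv (deriv u) t = 0 := by
    rw [integral_eq_sub_of_hasDerivAt (fun t _ => d2 t) (c2.intervalIntegrable _ _)]
    have := p1 0
    rw [zero_add] at this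
    rw [this, sub_self]
  have hLr : L + 2 * π * r = ∫ t in (0:ℝ)..(2 * π), (u t + r) := by
    rw [integral_add (c0.intervalIntegrable _ _) (by simp), integral_const, hL]
    simp
  have hAr : A + r * L + π * r ^ 2 =
      1 / 2 * ∫ t in (0:ℝ)..(2 * π), (u t + r) * (deriv (deriv u) t + (u t + r)) := by
    have E : ∫ t in (0:ℝ)..(2 * π), (u t + r) * (deriv (deriv u) t + (u t + r)) =
        ∫ t in (0:ℝ)..(2 * π), (u t * (deriv (deriv u) t + u t) + 2 * r * u t
          + r * deriv (deriv u) t + r ^ 2) := by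
      congr 1; ext t; ring
    rw [E, integral_add, integral_add, integral_add, integral_const_mul, integral_const_mul,
      integral_const, i2, ← hL, hA]
    · simp; ring
    all_goals exact Continuous.intervalIntegrable (by fun_prop) _ _
  obtain ⟨Apos, G⟩ := aux_gage (fun t => u t + r) (deriv u) (deriv (deriv u))
    (fun t => (d1 t).add_const r) d2 c2 (fun t => by simp [hper t]) p1 p2
    (fun t => by linarith [hconv t]) _ _ hLr hAr
  simp only [kk]
  simp only [← add_assoc] at G
  refine ⟨?_, by linarith⟩
  obtain ⟨D, m, mpos, hm⟩ := aux_deriv (fun t => deriv (deriv u) t + u t) (c2.add c0) hconv r hr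
  have DB : HasDerivAt (fun x => A + x * L + π * x ^ 2) (L + 2 * π * r) r := by
    refine ((((hasDerivAt_id r).mul_const L).const_add A).add
      (((hasDerivAt_id r).pow 2).const_mul π)).congr_deriv ?_
    simp; ring
  have DL : HasDerivAt (fun x => π * log ((A + x * L + π * x ^ 2) / π))
      (π * (L + 2 * π * r) / (A + r * L + π * r ^ 2)) r := by
    refine (((DB.div_const π).log (by positivity)).const_mul π).congr_deriv ?_
    field_simp
  refine (D.neg.add DL).congr_of_eventuallyEq ?_
  have ev1 : ∀ᶠ x in nhds r, 0 < A + x * L + π * x ^ 2 :=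
    DB.continuousAt.eventually (lt_mem_nhds Apos)
  have ev2 : ∀ᶠ x in nhds r, -m < x := lt_mem_nhds (by linarith)
  filter_upwards [ev1, ev2] with x hx1 hx2
  have pz : ∀ t ∈ Set.uIcc 0 (2 * π), 0 < deriv (deriv u) t + u t + x := by
    intro t ht
    rw [Set.uIcc_of_le (by positivity)] at ht
    have := hm t ht
    linarith
  have E : ∫ t in (0:ℝ)..(2 * π), log ((deriv (deriv u) t + u t + x)⁻¹ *
      √((A + x * L + π * x ^ 2) / π)) = ∫ t in (0:ℝ)..(2 * π),
      (-log (deriv (deriv u) t + u t + x) + 1 / 2 * log ((A + x * L + π * x ^ 2) / π)) := by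
    refine integral_congr fun t ht => ?_
    have h1 := pz t ht
    have h2 : 0 < (A + x * L + π * x ^ 2) / π := by positivity
    rw [log_mul (inv_pos.2 h1).ne' (sqrt_pos.2 h2).ne', log_inv, log_sqrt h2.le]
    ring
  rw [E, integral_add, integral_neg, integral_const]
  · simp only [Pi.add_apply, Pi.neg_apply, smul_eq_mul]
    ring
  · refine ContinuousOn.intervalIntegrable ?_
    refine (ContinuousOn.log ?_ fun t ht => (pz t ht).ne').neg
    exact (by fun_prop : Continuous fun t => deriv (deriv u) t + u t + x).continuousOn
  · simp
end
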